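/- There exists an absolute constant C₀ with the following property. Let G be a connected unweighted graph on n vertices, let t ≥ 1 be an integer, and let D ≥ 1 be real. Suppose that for every nonempty subset S ⊆ V(G), the induced subgraph G[S] admits a collection 𝒞 of pairwise disjoint nonempty clusters such that: each cluster induces a connected subgraph of G[S] of diameter at most D, any two distinct clusters are at distance at least 10t in G[S], and the clusters together contain at least |S|/2 vertices. Then G has a spanner H with at most n + n/t edges and stretch at most C₀·(D + t). -/

import Mathlib

open SimpleGraph

/-- Weighted shortest-path distance in a graph `G` with edge weights `w`
(`⊤` if `u` and `v` are not connected). For `w = fun _ => 1` this is the hop distance. -/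
noncomputable def wdist {V : Type*} (G : SimpleGraph V) (w : Sym2 V → NNReal) (u v : V) :
    ENNReal :=
  ⨅ p : G.Walk u v, ((p.edges.map w).sum : ENNReal)

/-- `H` is an `α`-spanner of the weighted graph `(G, w)`: `H` is a subgraph of `G` and
all pairwise distances are stretched by a factor of at most `α`. -/
def IsSpanner {V : Type*} (G H : SimpleGraph V) (w : Sym2 V → NNReal) (α : ℝ) : Prop :=
  H ≤ G ∧ ∀ u v : V, wdist H w u v ≤ ENNReal.ofReal α * wdist G w u v

/-- The subgraph of `G` induced by the vertex set `S` (kept on the same vertex type):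
only the edges of `G` with both endpoints in `S` are kept. -/
def within {V : Type*} (G : SimpleGraph V) (S : Set V) : SimpleGraph V :=
  SimpleGraph.fromRel (fun u v => G.Adj u v ∧ u ∈ S ∧ v ∈ S)

section UltrasparseSpanner

variable {V : Type*}

theorem within_adj {G : SimpleGraph V} {S : Set V} {u v : V} :
    (within G S).Adj u v ↔ G.Adj u v ∧ u ∈ S ∧ v ∈ S := by
  simp only [within, SimpleGraph.fromRel_adj]
  constructor
  · rintro ⟨-, h | h⟩
    · exact h
    · exact ⟨h.1.symm, h.2.2, h.2.1⟩
  · exact fun h => ⟨h.1.ne, Or.inl h⟩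

theorem wdist_one (G : SimpleGraph V) (u v : V) :
    wdist G (fun _ => 1) u v = ⨅ p : G.Walk u v, (p.length : ENNReal) := by
  simp [wdist]

/-- `G` has a subgraph with at most `|W|` edges in which every vertex `v` of `W` is joined to
`root v` by a walk of length at most `k`. -/
def HasShallowForest (G : SimpleGraph V) (root : V → V) (W : Set V) (k : ℕ) : Prop :=
  ∃ F : SimpleGraph V, F ≤ G ∧ F.edgeSet.ncard ≤ W.ncard ∧
    ∀ v ∈ W, ∃ p : F.Walk v (root v), p.length ≤ k

theorem hasShallowForest_zero (G : SimpleGraph V) {root : V → V} {W : Set V}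
    (h : ∀ v ∈ W, root v = v) : HasShallowForest G root W 0 := by
  refine ⟨⊥, bot_le, by simp, fun v hv => ?_⟩
  rw [h v hv]
  exact ⟨.nil, le_rfl⟩

theorem HasShallowForest.grow [Finite V] {G : SimpleGraph V} {root : V → V} {W W' : Set V}
    {k : ℕ} (hF : HasShallowForest G root W k) (hW : W ⊆ W')
    (h : ∀ v ∈ W', v ∉ W → ∃ w ∈ W, G.Adj v w ∧ root w = root v) :
    HasShallowForest G root W' (k + 1) := by
  obtain ⟨F, hFG, hcard, hwalk⟩ := hF
  have hpar : ∀ v, ∃ w, v ∈ W' → v ∉ W → w ∈ W ∧ G.Adj v w ∧ root w = root v := by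
    intro v
    by_cases hv : v ∈ W' ∧ v ∉ W
    · obtain ⟨w, hw⟩ := h v hv.1 hv.2
      exact ⟨w, fun _ _ => hw⟩
    · exact ⟨v, fun h1 h2 => absurd ⟨h1, h2⟩ hv⟩
  choose par hpar using hpar
  set E : Set (Sym2 V) := (fun v => s(v, par v)) '' (W' \ W)
  refine ⟨F ⊔ SimpleGraph.fromEdgeSet E, sup_le hFG ?_, ?_, ?_⟩
  · intro a b hab
    obtain ⟨⟨v, hv, hvab⟩, -⟩ := (SimpleGraph.fromEdgeSet_adj E).1 hab
    have hadj := (hpar v hv.1 hv.2).2.1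
    rwa [← SimpleGraph.mem_edgeSet, show s(v, par v) = s(a, b) from hvab,
      SimpleGraph.mem_edgeSet] at hadj
  · calc (F ⊔ SimpleGraph.fromEdgeSet E).edgeSet.ncard
        ≤ (F.edgeSet ∪ E).ncard := by
          refine Set.ncard_le_ncard ?_ (Set.toFinite _)
          rw [SimpleGraph.edgeSet_sup, SimpleGraph.edgeSet_fromEdgeSet]
          exact Set.union_subset_union_right _ Set.sdiff_subset
      _ ≤ F.edgeSet.ncard + E.ncard := Set.ncard_union_le _ _
      _ ≤ W.ncard + (W' \ W).ncard := add_le_add hcard (Set.ncard_image_le (Set.toFinite _))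
      _ = W'.ncard := by
          rw [add_comm]
          exact Set.ncard_sdiff_add_ncard_of_subset hW (Set.toFinite _)
  · intro v hv
    by_cases hvW : v ∈ W
    · obtain ⟨p, hp⟩ := hwalk v hvW
      exact ⟨p.mapLe le_sup_left, by simpa using hp.trans (Nat.le_succ k)⟩
    · obtain ⟨hw, hadj, hroot⟩ := hpar v hv hvW
      obtain ⟨p, hp⟩ := hwalk _ hw
      have hadj' : (F ⊔ SimpleGraph.fromEdgeSet E).Adj v (par v) :=
        Or.inr ((SimpleGraph.fromEdgeSet_adj E).2 ⟨⟨v, ⟨hv, hvW⟩, rfl⟩, hadj.ne⟩)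
      rw [← hroot]
      exact ⟨.cons hadj' (p.mapLe le_sup_left), by simpa using hp⟩

/-- The vertices joined to some vertex of `C` by a walk in `G` of length at most `k`. -/
def nbhd (G : SimpleGraph V) (C : Set V) (k : ℕ) : Set V :=
  {v | ∃ x ∈ C, ∃ p : G.Walk v x, p.length ≤ k}

theorem nbhd_zero (G : SimpleGraph V) (C : Set V) : nbhd G C 0 = C := by
  ext v
  constructor
  · rintro ⟨x, hx, p, hp⟩
    rwa [p.eq_of_length_eq_zero (Nat.le_zero.1 hp)]
  · exact fun hv => ⟨v, hv, .nil, le_rfl⟩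

theorem nbhd_mono (G : SimpleGraph V) (C : Set V) : Monotone (nbhd G C) :=
  fun _ _ hkl _ ⟨x, hx, p, hp⟩ => ⟨x, hx, p, hp.trans hkl⟩

theorem mem_nbhd_succ_of_adj {G : SimpleGraph V} {C : Set V} {k : ℕ} {u v : V}
    (hu : u ∈ nbhd G C k) (h : G.Adj v u) : v ∈ nbhd G C (k + 1) := by
  obtain ⟨x, hx, p, hp⟩ := hu
  exact ⟨x, hx, .cons h p, by simpa using hp⟩

theorem mem_or_exists_adj_of_mem_nbhd_succ {G : SimpleGraph V} {C : Set V} {k : ℕ} {v : V}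
    (hv : v ∈ nbhd G C (k + 1)) : v ∈ C ∨ ∃ w ∈ nbhd G C k, G.Adj v w := by
  obtain ⟨x, hx, p, hp⟩ := hv
  cases p with
  | nil => exact Or.inl hx
  | cons h q => exact Or.inr ⟨_, ⟨x, hx, q, by simpa using hp⟩, h⟩

theorem nbhd_within_subset {G : SimpleGraph V} {S C : Set V} (hC : C ⊆ S) (k : ℕ) :
    nbhd (within G S) C k ⊆ S := by
  rintro v ⟨x, hx, p, -⟩
  cases p with
  | nil => exact hC hx
  | cons h _ => exact (within_adj.1 h).2.1

/-- If a family of sets is separated by more than `2 * t`, then their `t`-neighbourhoods are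
disjoint. -/
theorem eq_of_mem_nbhd {ι : Type*} {G : SimpleGraph V} {cl : ι → Set V} {t s : ℕ}
    (hts : 2 * t < s)
    (hsep : ∀ i j, i ≠ j → ∀ u ∈ cl i, ∀ v ∈ cl j,
      (s : ENNReal) ≤ wdist G (fun _ => 1) u v)
    {i j : ι} {v : V} (hi : v ∈ nbhd G (cl i) t) (hj : v ∈ nbhd G (cl j) t) : i = j := by
  by_contra hij
  obtain ⟨x, hx, p, hp⟩ := hi
  obtain ⟨y, hy, q, hq⟩ := hj
  have h := (hsep i j hij x hx y hy).trans
    ((wdist_one G x y).trans_le (iInf_le _ (p.reverse.append q)))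
  have h' : s ≤ (p.reverse.append q).length := by exact_mod_cast h
  rw [SimpleGraph.Walk.length_append, SimpleGraph.Walk.length_reverse] at h'
  omega

theorem exists_mul_succ_le_add {a : ℕ → ℕ} {t : ℕ} (ht : 1 ≤ t) (h : a t ≤ 2 * a 0) :
    ∃ r < t, t * a (r + 1) ≤ t * a r + a 0 := by
  by_contra! hcon
  have key : ∀ k ≤ t, t * a 0 + k * a 0 + k ≤ t * a k := by
    intro k
    induction k with
    | zero => simp
    | succ k ih =>
      intro hk
      have h1 := ih (by omega)
      have h2 := hcon k (by omega)
      rw [Nat.succ_mul]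
      omega
  have h1 := key t le_rfl
  have h2 := Nat.mul_le_mul_left t h
  have h3 : t * (2 * a 0) = t * a 0 + t * a 0 := by ring
  omega

/-- Growing the clusters of a separated strong-diameter clustering of `G[S]` to a common radius
gives a set `B` containing many vertices of `S`, all of whose incident edges in `G[S]` are spanned
by a subgraph with few edges. -/
theorem exists_spanning_subgraph_of_clustering [Finite V] {G : SimpleGraph V} {S : Set V}
    {ι : Type*} {cl : ι → Set V} {t d : ℕ} (ht : 1 ≤ t)
    (hne : ∀ i, (cl i).Nonempty) (hS : ∀ i, cl i ⊆ S)
    (hdiam : ∀ i, ∀ u ∈ cl i, ∀ v ∈ cl i, ∃ p : (within G (cl i)).Walk u v, p.length ≤ d)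
    (hsep : ∀ i j, i ≠ j → ∀ u ∈ cl i, ∀ v ∈ cl j,
      ((10 * t : ℕ) : ENNReal) ≤ wdist (within G S) (fun _ => 1) u v)
    (hhalf : S.ncard ≤ 2 * (⋃ i, cl i).ncard) :
    ∃ B ⊆ S, (⋃ i, cl i) ⊆ B ∧ ∃ F ≤ G, t * F.edgeSet.ncard ≤ t * B.ncard + B.ncard ∧
      ∀ u ∈ B, ∀ v ∈ S, G.Adj u v → ∃ p : F.Walk u v, p.length ≤ 2 * (d + t) := by
  classical
  choose c hc using hne
  have huniq : ∀ {i j v}, v ∈ nbhd (within G S) (cl i) t →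
      v ∈ nbhd (within G S) (cl j) t → i = j := eq_of_mem_nbhd (by omega) hsep
  have hroot : ∃ root : V → V, ∀ i, ∀ v ∈ nbhd (within G S) (cl i) t, root v = c i := by
    refine ⟨fun v => if h : ∃ i, v ∈ nbhd (within G S) (cl i) t then c h.choose else v, ?_⟩
    intro i v hv
    have h : ∃ i, v ∈ nbhd (within G S) (cl i) t := ⟨i, hv⟩
    simp only [dif_pos h]
    rw [huniq h.choose_spec hv]
  obtain ⟨root, hroot⟩ := hroot
  have hcl : ∀ i k, cl i ⊆ nbhd (within G S) (cl i) k := fun i k => by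
    conv_lhs => rw [← nbhd_zero (within G S) (cl i)]
    exact nbhd_mono _ _ (Nat.zero_le k)
  have hcenter : ∀ i k, nbhd (within G (cl i)) {c i} k ⊆ cl i := fun i k =>
    nbhd_within_subset (Set.singleton_subset_iff.2 (hc i)) k
  have hinner : ∀ k, HasShallowForest G root (⋃ i, nbhd (within G (cl i)) {c i} k) k := by
    intro k
    induction k with
    | zero =>
      refine hasShallowForest_zero G fun v hv => ?_
      obtain ⟨i, hi⟩ := Set.mem_iUnion.1 hv
      have hvi := hroot i v (hcl i t (hcenter i 0 hi))
      rw [nbhd_zero, Set.mem_singleton_iff] at hi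
      rw [hvi, hi]
    | succ k ih =>
      refine ih.grow (Set.iUnion_mono fun i => nbhd_mono _ _ (Nat.le_succ k)) ?_
      intro v hv hvW
      obtain ⟨i, hi⟩ := Set.mem_iUnion.1 hv
      rcases mem_or_exists_adj_of_mem_nbhd_succ hi with h | ⟨w, hw, hadj⟩
      · refine absurd (Set.mem_iUnion.2 ⟨i, ?_⟩) hvW
        exact nbhd_mono _ _ (Nat.zero_le k) ((nbhd_zero _ _).symm ▸ h)
      · refine ⟨w, Set.mem_iUnion.2 ⟨i, hw⟩, (within_adj.1 hadj).1, ?_⟩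
        rw [hroot i w (hcl i t (hcenter i k hw)), hroot i v (hcl i t (hcenter i _ hi))]
  have hfull : (⋃ i, nbhd (within G (cl i)) {c i} d) = ⋃ i, cl i :=
    Set.iUnion_congr fun i => (hcenter i d).antisymm fun v hv =>
      ⟨c i, rfl, hdiam i v hv (c i) (hc i)⟩
  have houter : ∀ k ≤ t,
      HasShallowForest G root (⋃ i, nbhd (within G S) (cl i) k) (d + k) := by
    intro k
    induction k with
    | zero =>
      intro _
      simpa only [nbhd_zero, hfull, Nat.add_zero] using hinner d
    | succ k ih =>
      intro hk
      refine (ih (by omega)).grow (Set.iUnion_mono fun i => nbhd_mono _ _ (Nat.le_succ k)) ?_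
      intro v hv hvW
      obtain ⟨i, hi⟩ := Set.mem_iUnion.1 hv
      rcases mem_or_exists_adj_of_mem_nbhd_succ hi with h | ⟨w, hw, hadj⟩
      · exact absurd (Set.mem_iUnion.2 ⟨i, hcl i k h⟩) hvW
      · refine ⟨w, Set.mem_iUnion.2 ⟨i, hw⟩, (within_adj.1 hadj).1, ?_⟩
        rw [hroot i w (nbhd_mono _ _ (by omega) hw), hroot i v (nbhd_mono _ _ hk hi)]
  have hsub : ∀ k, (⋃ i, nbhd (within G S) (cl i) k) ⊆ S := fun k =>
    Set.iUnion_subset fun i => nbhd_within_subset (hS i) k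
  obtain ⟨r, hrt, hr⟩ := exists_mul_succ_le_add
    (a := fun k => (⋃ i, nbhd (within G S) (cl i) k).ncard) ht (by
      simp only [nbhd_zero]
      exact (Set.ncard_le_ncard (hsub t) (Set.toFinite _)).trans hhalf)
  simp only [nbhd_zero] at hr
  have hclB : (⋃ i, cl i) ⊆ ⋃ i, nbhd (within G S) (cl i) r := Set.iUnion_mono fun i => hcl i r
  obtain ⟨F, hFG, hcard, hwalk⟩ := houter (r + 1) hrt
  refine ⟨_, hsub r, hclB, F, hFG, ?_, ?_⟩
  · have h1 := Set.ncard_le_ncard hclB (Set.toFinite _)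
    have h2 := Nat.mul_le_mul_left t hcard
    omega
  · intro u hu v hv hadj
    have huS := hsub r hu
    obtain ⟨i, hi⟩ := Set.mem_iUnion.1 hu
    have hui : u ∈ nbhd (within G S) (cl i) (r + 1) := nbhd_mono _ _ (Nat.le_succ r) hi
    have hvi : v ∈ nbhd (within G S) (cl i) (r + 1) :=
      mem_nbhd_succ_of_adj hi (within_adj.2 ⟨hadj.symm, hv, huS⟩)
    obtain ⟨p, hp⟩ := hwalk u (Set.mem_iUnion.2 ⟨i, hui⟩)
    obtain ⟨q, hq⟩ := hwalk v (Set.mem_iUnion.2 ⟨i, hvi⟩)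
    have hrt' : r + 1 ≤ t := hrt
    have huv : root v = root u := by
      rw [hroot i u (nbhd_mono _ _ hrt' hui), hroot i v (nbhd_mono _ _ hrt' hvi)]
    refine ⟨p.append (q.reverse.copy huv rfl), ?_⟩
    rw [SimpleGraph.Walk.length_append, SimpleGraph.Walk.length_copy,
      SimpleGraph.Walk.length_reverse]
    omega

/-- If every nonempty `S` contains a nonempty `B` whose incident edges in `G[S]` are spanned by few
edges, then peeling off such sets one after another spans all edges of `G[S]`. -/
theorem exists_spanning_subgraph_of_peeling [Finite V] {G : SimpleGraph V} {t K : ℕ}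
    (hpeel : ∀ S : Set V, S.Nonempty → ∃ B ⊆ S, B.Nonempty ∧
      ∃ F ≤ G, t * F.edgeSet.ncard ≤ t * B.ncard + B.ncard ∧
        ∀ u ∈ B, ∀ v ∈ S, G.Adj u v → ∃ p : F.Walk u v, p.length ≤ K) (S : Set V) :
    ∃ H ≤ G, t * H.edgeSet.ncard ≤ t * S.ncard + S.ncard ∧
      ∀ u ∈ S, ∀ v ∈ S, G.Adj u v → ∃ p : H.Walk u v, p.length ≤ K := by
  induction hn : S.ncard using Nat.strong_induction_on generalizing S with
  | _ n ih =>
    subst hn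
    rcases S.eq_empty_or_nonempty with rfl | hS
    · exact ⟨⊥, bot_le, by simp, by simp⟩
    obtain ⟨B, hBS, hB, F, hFG, hFcard, hF⟩ := hpeel S hS
    have hsplit := Set.ncard_sdiff_add_ncard_of_subset hBS (Set.toFinite S)
    have hBpos := (Set.ncard_pos (Set.toFinite B)).2 hB
    obtain ⟨H, hHG, hHcard, hH⟩ := ih (S \ B).ncard (by omega) (S \ B) rfl
    refine ⟨F ⊔ H, sup_le hFG hHG, ?_, ?_⟩
    · have h1 : (F ⊔ H).edgeSet.ncard ≤ F.edgeSet.ncard + H.edgeSet.ncard := by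
        rw [SimpleGraph.edgeSet_sup]
        exact Set.ncard_union_le _ _
      rw [← hsplit]
      nlinarith [Nat.mul_le_mul_left t h1]
    · intro u hu v hv hadj
      by_cases huB : u ∈ B
      · obtain ⟨p, hp⟩ := hF u huB v hv hadj
        exact ⟨p.mapLe le_sup_left, by simpa using hp⟩
      by_cases hvB : v ∈ B
      · obtain ⟨p, hp⟩ := hF v hvB u hu hadj.symm
        exact ⟨(p.mapLe le_sup_left).reverse, by simpa using hp⟩
      · obtain ⟨p, hp⟩ := hH u ⟨hu, huB⟩ v ⟨hv, hvB⟩ hadj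
        exact ⟨p.mapLe le_sup_right, by simpa using hp⟩

theorem isSpanner_of_adj {G H : SimpleGraph V} {K : ℕ} {α : ℝ} (hHG : H ≤ G) (hα : 0 < α)
    (hK : (K : ℝ) ≤ α) (h : ∀ u v, G.Adj u v → ∃ p : H.Walk u v, p.length ≤ K) :
    IsSpanner G H (fun _ => 1) α := by
  refine ⟨hHG, fun u v => ?_⟩
  have hwalk : ∀ {u v} (p : G.Walk u v), ∃ q : H.Walk u v, q.length ≤ K * p.length := by
    intro u v p
    induction p with
    | nil => exact ⟨.nil, by simp⟩
    | cons hadj _ ih =>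
      obtain ⟨q, hq⟩ := ih
      obtain ⟨q', hq'⟩ := h _ _ hadj
      refine ⟨q'.append q, ?_⟩
      rw [SimpleGraph.Walk.length_append, SimpleGraph.Walk.length_cons]
      linarith
  rw [wdist_one, wdist_one, ENNReal.mul_iInf_of_ne (by simpa using hα) ENNReal.ofReal_ne_top]
  refine le_iInf fun p => ?_
  obtain ⟨q, hq⟩ := hwalk p
  calc (⨅ q : H.Walk u v, (q.length : ENNReal)) ≤ q.length := iInf_le _ q
    _ ≤ ((K * p.length : ℕ) : ENNReal) := by exact_mod_cast hq
    _ = (K : ENNReal) * p.length := by push_cast; rfl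
    _ ≤ ENNReal.ofReal α * p.length := by
      gcongr
      rw [← ENNReal.ofReal_natCast]
      exact ENNReal.ofReal_le_ofReal hK

end UltrasparseSpanner

/-- if every induced subgraph `G[S]` of a connected `n`-vertex graph `G`
admits a `10t`-separated strong-diameter clustering with diameter at most `D` covering at
least half of `S`, then `G` has an ultra-sparse spanner with at most `n + n/t` edges and
stretch `O(D + t)`. -/
theorem ultrasparse_spanner_of_strong_diameter_clustering :
    ∃ C₀ : ℝ, 0 < C₀ ∧
      ∀ (n : ℕ) (G : SimpleGraph (Fin n)), G.Connected →
        ∀ (t : ℕ), 1 ≤ t → ∀ (D : ℝ), 1 ≤ D →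
          (∀ S : Set (Fin n), S.Nonempty →
            ∃ (m : ℕ) (cl : Fin m → Set (Fin n)),
              (∀ i, (cl i).Nonempty) ∧
              (∀ i, cl i ⊆ S) ∧
              (Pairwise fun i j => Disjoint (cl i) (cl j)) ∧
              (∀ i, ∀ u ∈ cl i, ∀ v ∈ cl i,
                ∃ p : (within G (cl i)).Walk u v, (p.length : ℝ) ≤ D) ∧
              (∀ i j, i ≠ j → ∀ u ∈ cl i, ∀ v ∈ cl j,
                ((10 * t : ℕ) : ENNReal) ≤ wdist (within G S) (fun _ => 1) u v) ∧
              ((S.ncard : ℝ) / 2 ≤ ((⋃ i, cl i).ncard : ℝ))) →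
          ∃ H : SimpleGraph (Fin n),
            IsSpanner G H (fun _ => 1) (C₀ * (D + t)) ∧
            (H.edgeSet.ncard : ℝ) ≤ n + (n : ℝ) / t := by
  refine ⟨2, two_pos, fun n G _ t ht D hD hclust => ?_⟩
  have hD0 : 0 ≤ D := zero_le_one.trans hD
  obtain ⟨H, hHG, hcard, hH⟩ := exists_spanning_subgraph_of_peeling (G := G) (t := t)
    (K := 2 * (⌊D⌋₊ + t)) (fun S hS => by
      obtain ⟨m, cl, hne, hsub, -, hdiam, hsep, hhalf⟩ := hclust S hS
      have hhalf' : S.ncard ≤ 2 * (⋃ i, cl i).ncard := by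
        have : (S.ncard : ℝ) ≤ 2 * ((⋃ i, cl i).ncard : ℝ) := by linarith
        exact_mod_cast this
      obtain ⟨B, hBS, hclB, F, hF⟩ := exists_spanning_subgraph_of_clustering (d := ⌊D⌋₊) ht hne
        hsub (fun i u hu v hv => (hdiam i u hu v hv).imp fun p hp => Nat.le_floor hp) hsep hhalf'
      have hpos := (Set.ncard_pos (Set.toFinite S)).2 hS
      exact ⟨B, hBS, (Set.nonempty_of_ncard_ne_zero (by omega)).mono hclB, F, hF⟩) Set.univ
  have htpos : (0 : ℝ) < t := by exact_mod_cast ht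
  refine ⟨H, isSpanner_of_adj hHG (by positivity) (K := 2 * (⌊D⌋₊ + t)) ?_
    fun u v => hH u trivial v trivial, ?_⟩
  · push_cast
    have := Nat.floor_le hD0
    linarith
  · have hcard' : (t : ℝ) * H.edgeSet.ncard ≤ t * n + n := by
      rw [Set.ncard_univ, Nat.card_fin] at hcard
      exact_mod_cast hcard
    rw [← mul_le_mul_iff_right₀ htpos, mul_add, mul_div_cancel₀ _ htpos.ne']
    exact hcard'
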